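/- Let K be a perfect (i.e., without isolated points) compact Hausdorff topological space and let X be a C-rich closed subspace of C(K,𝕜), 𝕜 = ℝ or ℂ. Then the numerical index of X equals 1 and X has the Daugavet property. -/

import Mathlib

/-- The numerical range of a bounded linear operator `T` on a Banach space `X` over `𝕜`:
the set of values `f (T x)` where `‖x‖ = 1`, `‖f‖ = 1` and `f x = 1`. -/
def numericalRange (𝕜 : Type*) {X : Type*} [RCLike 𝕜] [NormedAddCommGroup X]
    [NormedSpace 𝕜 X] (T : X →L[𝕜] X) : Set 𝕜 :=
  {lam | ∃ (x : X) (f : X →L[𝕜] 𝕜), ‖x‖ = 1 ∧ ‖f‖ = 1 ∧ f x = 1 ∧ lam = f (T x)}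

/-- The numerical radius `v(T) = sup { |λ| : λ ∈ V(T) }`. -/
noncomputable def numericalRadius (𝕜 : Type*) {X : Type*} [RCLike 𝕜] [NormedAddCommGroup X]
    [NormedSpace 𝕜 X] (T : X →L[𝕜] X) : ℝ :=
  sSup ((fun lam => ‖lam‖) '' numericalRange 𝕜 T)

/-- The numerical index `n(X) = inf { v(T) : T ∈ L(X), ‖T‖ = 1 }`. -/
noncomputable def numericalIndex (𝕜 X : Type*) [RCLike 𝕜] [NormedAddCommGroup X]
    [NormedSpace 𝕜 X] : ℝ :=
  sInf (numericalRadius 𝕜 '' {T : X →L[𝕜] X | ‖T‖ = 1})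

/-- A closed subspace `X` of `C(K, 𝕜)` is C-rich if for every nonempty open set `U ⊆ K` and
every `ε > 0` there is a continuous function `h : K → [0,1]` of norm one with support inside `U`
whose distance to `X` is less than `ε`. -/
def CRich (𝕜 : Type*) [RCLike 𝕜] {K : Type*} [TopologicalSpace K] [CompactSpace K]
    (X : Submodule 𝕜 C(K, 𝕜)) : Prop :=
  ∀ U : Set K, IsOpen U → U.Nonempty → ∀ ε : ℝ, 0 < ε →
    ∃ h : C(K, ℝ), (∀ t, h t ∈ Set.Icc (0 : ℝ) 1) ∧ ‖h‖ = 1 ∧ tsupport ⇑h ⊆ U ∧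
      ∃ g ∈ X, ‖(⟨fun t => ((h t : ℝ) : 𝕜), RCLike.continuous_ofReal.comp h.continuous⟩
        : C(K, 𝕜)) - g‖ < ε

theorem aux_unimodular {𝕜 : Type*} [RCLike 𝕜] (a : 𝕜) :
    ∃ b : 𝕜, ‖b‖ = 1 ∧ a = (‖a‖ : 𝕜) * b := by
  by_cases h : a = 0
  · exact ⟨1, by simp, by simp [h]⟩
  · have h' : (‖a‖ : 𝕜) ≠ 0 := by simpa using h
    refine ⟨a / ‖a‖, ?_, ?_⟩
    · simp [h]
    · field_simp

theorem aux_rich {𝕜 K : Type*} [RCLike 𝕜] [TopologicalSpace K] [CompactSpace K] [Nonempty K]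
    {X : Submodule 𝕜 C(K, 𝕜)} (hrich : CRich 𝕜 X) (U : Set K) (hU : IsOpen U)
    (hne : U.Nonempty) (ε : ℝ) (hε : 0 < ε) :
    ∃ (h : K → ℝ) (g : X), (∀ t, 0 ≤ h t ∧ h t ≤ 1) ∧ (∃ t ∈ U, h t = 1) ∧
      (∀ t, t ∉ U → h t = 0) ∧ ∀ t, ‖(g : C(K, 𝕜)) t - (h t : 𝕜)‖ ≤ ε := by
  obtain ⟨h, h01, hn, hs, g, hg, hgε⟩ := hrich U hU hne ε hε
  have hout : ∀ t, t ∉ U → h t = 0 := fun t ht => image_eq_zero_of_notMem_tsupport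
    (fun h' => ht (hs h'))
  obtain ⟨t0, -, ht0⟩ := isCompact_univ.exists_isMaxOn Set.univ_nonempty h.continuous.continuousOn
  have h1 : h t0 = 1 := by
    apply le_antisymm (h01 t0).2
    rw [← hn, ContinuousMap.norm_le _ (h01 t0).1]
    intro s
    rw [Real.norm_eq_abs, abs_of_nonneg (h01 s).1]
    exact ht0 (Set.mem_univ s)
  refine ⟨h, ⟨g, hg⟩, fun t => h01 t, ⟨t0, ?_, h1⟩, hout, fun t => ?_⟩
  · by_contra hc
    have := hout t0 hc
    linarith
  · have := ContinuousMap.norm_coe_le_norm ((⟨fun t => ((h t : ℝ) : 𝕜),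
      RCLike.continuous_ofReal.comp h.continuous⟩ : C(K, 𝕜)) - g) t
    rw [norm_sub_rev]
    exact this.trans hgε.le

theorem aux_small {𝕜 K : Type*} [RCLike 𝕜] [TopologicalSpace K] [CompactSpace K] [T2Space K]
    [Nonempty K] [PerfectSpace K]
    {X : Submodule 𝕜 C(K, 𝕜)} (hrich : CRich 𝕜 X) (φ : X →L[𝕜] 𝕜) (U : Set K) (hU : IsOpen U)
    (hne : U.Nonempty) (ε : ℝ) (hε : 0 < ε) :
    ∃ (h : K → ℝ) (g : X), (∀ t, 0 ≤ h t ∧ h t ≤ 1) ∧ (∃ t ∈ U, h t = 1) ∧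
      (∀ t, t ∉ U → h t = 0) ∧ (∀ t, ‖(g : C(K, 𝕜)) t - (h t : 𝕜)‖ ≤ ε) ∧ ‖φ g‖ ≤ ε := by
  by_contra hcon
  push Not at hcon
  obtain ⟨t0, ht0⟩ := hne
  have hinf : U.Infinite := infinite_of_mem_nhds t0 (hU.mem_nhds ht0)
  have : Infinite U := hinf.to_subtype
  obtain ⟨W, hWinf, hWo, hWd⟩ := exists_seq_infinite_isOpen_pairwise_disjoint U
  obtain ⟨N, hN⟩ := exists_nat_gt (2 * ‖φ‖ / ε)
  have hNpos : (0 : ℝ) < N := lt_of_le_of_lt (by positivity) hN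
  set δ : ℝ := min ε (1 / N) with hδ
  have hδpos : 0 < δ := lt_min hε (by positivity)
  let V : ℕ → Set K := fun n => Subtype.val '' W n
  have hVU : ∀ n, V n ⊆ U := by
    rintro n _ ⟨x, -, rfl⟩; exact x.2
  have hVd : ∀ i j t, t ∈ V i → t ∈ V j → i = j := by
    rintro i j _ ⟨x, hx, rfl⟩ ⟨y, hy, hxy⟩
    have : y = x := Subtype.ext hxy
    subst this
    by_contra hij
    exact Set.disjoint_left.1 (hWd hij) hx hy
  choose h g h01 hpk hout hgh using fun n => aux_rich hrich (V n)
    (hU.isOpenMap_subtype_val _ (hWo n)) ((hWinf n).nonempty.image _) δ hδpos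
  have hbig : ∀ n, ε < ‖φ (g n)‖ := by
    intro n
    obtain ⟨t, ht, ht1⟩ := hpk n
    exact hcon (h n) (g n) (h01 n) ⟨t, hVU n ht, ht1⟩
      (fun t ht => hout n t (fun h' => ht (hVU n h')))
      (fun t => (hgh n t).trans (min_le_left _ _))
  have hc : ∀ n, ∃ c : 𝕜, ‖c‖ = 1 ∧ c * φ (g n) = (‖φ (g n)‖ : 𝕜) := by
    intro n
    obtain ⟨b, hb, hb'⟩ := aux_unimodular (φ (g n))
    have hb0 : b ≠ 0 := by
      intro h0; simp [h0] at hb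
    refine ⟨b⁻¹, by simp [hb], ?_⟩
    nth_rewrite 1 [hb']
    field_simp
  choose c hc1 hc2 using hc
  let z : X := ∑ i ∈ Finset.range N, c i • g i
  have hzt : ∀ t, (z : C(K, 𝕜)) t = ∑ i ∈ Finset.range N, c i * (g i : C(K, 𝕜)) t := by
    intro t
    simp [z]
  have hz : ‖z‖ ≤ 2 := by
    rw [Submodule.coe_norm, ContinuousMap.norm_le _ (by norm_num)]
    intro t
    rw [hzt]
    have e : ∑ i ∈ Finset.range N, c i * (g i : C(K, 𝕜)) t
        = ∑ i ∈ Finset.range N, c i * (h i t : 𝕜)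
          + ∑ i ∈ Finset.range N, c i * ((g i : C(K, 𝕜)) t - (h i t : 𝕜)) := by
      rw [← Finset.sum_add_distrib]
      exact Finset.sum_congr rfl fun i _ => by ring
    rw [e]
    have e1 : ‖∑ i ∈ Finset.range N, c i * (h i t : 𝕜)‖ ≤ 1 := by
      by_cases hex : ∃ j ∈ Finset.range N, t ∈ V j
      · obtain ⟨j, hj, hjt⟩ := hex
        rw [Finset.sum_eq_single_of_mem j hj]
        · rw [norm_mul, hc1, one_mul, RCLike.norm_ofReal, abs_of_nonneg (h01 j t).1]
          exact (h01 j t).2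
        · intro i _ hij
          rw [hout i t (fun hi => hij (hVd i j t hi hjt))]
          simp
      · rw [Finset.sum_eq_zero]
        · simp
        · intro i hi
          rw [hout i t (fun h' => hex ⟨i, hi, h'⟩)]
          simp
    have e2 : ‖∑ i ∈ Finset.range N, c i * ((g i : C(K, 𝕜)) t - (h i t : 𝕜))‖ ≤ 1 := by
      refine (norm_sum_le_of_le _ (f := fun i => c i * ((g i : C(K, 𝕜)) t - (h i t : 𝕜)))
        (n := fun _ => 1 / (N : ℝ)) ?_).trans ?_
      · intro i _
        rw [norm_mul, hc1, one_mul]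
        exact (hgh i t).trans (min_le_right _ _)
      · simp only [Finset.sum_const, Finset.card_range, nsmul_eq_mul]
        field_simp
        exact le_refl _
    calc _ ≤ _ := norm_add_le _ _
      _ ≤ 2 := by linarith
  have hφz : φ z = ((∑ i ∈ Finset.range N, ‖φ (g i)‖ : ℝ) : 𝕜) := by
    simp only [z, map_sum, map_smul, smul_eq_mul]
    exact Finset.sum_congr rfl fun i _ => hc2 i
  have h1 : N * ε ≤ ∑ i ∈ Finset.range N, ‖φ (g i)‖ := by
    have := Finset.card_nsmul_le_sum (Finset.range N) (fun i => ‖φ (g i)‖) ε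
      (fun i _ => (hbig i).le)
    simpa using this
  have h2 : ‖φ z‖ ≤ ‖φ‖ * 2 := (φ.le_opNorm z).trans (by gcongr)
  rw [hφz, RCLike.norm_ofReal] at h2
  have h3 := (le_abs_self _).trans h2
  rw [div_lt_iff₀ hε] at hN
  linarith

theorem aux_key {𝕜 K : Type*} [RCLike 𝕜] [TopologicalSpace K] [CompactSpace K] [T2Space K]
    [Nonempty K] [PerfectSpace K]
    {X : Submodule 𝕜 C(K, 𝕜)} (hrich : CRich 𝕜 X) (φ : X →L[𝕜] 𝕜) (x y : X) (hx : ‖x‖ ≤ 1)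
    (t0 : K) (ε : ℝ) (hε : 0 < ε) :
    ∃ (g : X) (t : K), ‖(y : C(K, 𝕜)) t - (y : C(K, 𝕜)) t0‖ ≤ ε ∧ ‖φ g‖ ≤ ε ∧
      ∀ b : 𝕜, ‖b‖ = 1 → ‖x + (b - (x : C(K, 𝕜)) t0) • g‖ ≤ 1 + ε ∧
        ‖((x + (b - (x : C(K, 𝕜)) t0) • g : X) : C(K, 𝕜)) t - b‖ ≤ ε := by
  have hη : 0 < ε / 3 := by positivity
  set η := ε / 3 with hηe
  have hxt : ∀ s, ‖(x : C(K, 𝕜)) s‖ ≤ 1 := fun s =>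
    (ContinuousMap.norm_coe_le_norm (x : C(K, 𝕜)) s).trans hx
  set a := (x : C(K, 𝕜)) t0 with ha
  let U : Set K := {s | ‖(x : C(K, 𝕜)) s - a‖ < η} ∩
    {s | ‖(y : C(K, 𝕜)) s - (y : C(K, 𝕜)) t0‖ < η}
  have hU : IsOpen U := by
    apply IsOpen.inter
    · exact isOpen_lt (by fun_prop) continuous_const
    · exact isOpen_lt (by fun_prop) continuous_const
  have hU0 : t0 ∈ U := by
    constructor
    · simpa [ha] using hη
    · simpa using hη
  obtain ⟨h, g, h01, ⟨t, htU, ht1⟩, hout, hgh, hφ⟩ := aux_small hrich φ U hU ⟨t0, hU0⟩ η hη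
  refine ⟨g, t, ?_, ?_, ?_⟩
  · exact htU.2.le.trans (by linarith)
  · linarith
  intro b hb
  have hba : ‖b - a‖ ≤ 2 := (norm_sub_le _ _).trans (by linarith [hxt t0])
  have hval : ∀ s, ((x + (b - a) • g : X) : C(K, 𝕜)) s
      = (x : C(K, 𝕜)) s + (b - a) * (g : C(K, 𝕜)) s := by
    intro s; simp
  have herr : ∀ s, ‖(b - a) * ((g : C(K, 𝕜)) s - (h s : 𝕜))‖ ≤ 2 * η := by
    intro s
    rw [norm_mul]
    exact mul_le_mul hba (hgh s) (norm_nonneg _) (by norm_num)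
  constructor
  · rw [Submodule.coe_norm, ContinuousMap.norm_le _ (by positivity)]
    intro s
    rw [hval]
    by_cases hs : s ∈ U
    · have e : (x : C(K, 𝕜)) s + (b - a) * (g : C(K, 𝕜)) s
          = ((x : C(K, 𝕜)) s - a) + (((1 - h s : ℝ) : 𝕜) * a + (h s : 𝕜) * b)
            + (b - a) * ((g : C(K, 𝕜)) s - (h s : 𝕜)) := by
        push_cast; ring
      rw [e]
      have e1 : ‖((1 - h s : ℝ) : 𝕜) * a + (h s : 𝕜) * b‖ ≤ 1 := by
        refine (norm_add_le _ _).trans ?_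
        rw [norm_mul, norm_mul, RCLike.norm_ofReal, RCLike.norm_ofReal, hb,
          abs_of_nonneg (h01 s).1, abs_of_nonneg (by linarith [(h01 s).2])]
        nlinarith [hxt t0, (h01 s).1, (h01 s).2]
      have e2 : ‖(x : C(K, 𝕜)) s - a‖ < η := hs.1
      refine (norm_add₃_le).trans ?_
      linarith [herr s]
    · have e : (x : C(K, 𝕜)) s + (b - a) * (g : C(K, 𝕜)) s
          = (x : C(K, 𝕜)) s + (b - a) * ((g : C(K, 𝕜)) s - (h s : 𝕜)) := by
        rw [hout s hs]; simp
      rw [e]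
      refine (norm_add_le _ _).trans ?_
      linarith [herr s, hxt s]
  · have e : (x : C(K, 𝕜)) t + (b - a) * (g : C(K, 𝕜)) t - b
        = ((x : C(K, 𝕜)) t - a) + (b - a) * ((g : C(K, 𝕜)) t - (h t : 𝕜)) := by
      rw [ht1]; push_cast; ring
    rw [hval, e]
    have e2 : ‖(x : C(K, 𝕜)) t - a‖ < η := htU.1
    refine (norm_add_le _ _).trans ?_
    linarith [herr t]

theorem aux_attain {𝕜 K : Type*} [RCLike 𝕜] [TopologicalSpace K] [CompactSpace K]
    [Nonempty K] (y : C(K, 𝕜)) : ∃ t, ‖y t‖ = ‖y‖ := by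
  obtain ⟨t0, -, ht0⟩ := isCompact_univ.exists_isMaxOn Set.univ_nonempty
    y.continuous.norm.continuousOn
  refine ⟨t0, le_antisymm (y.norm_coe_le_norm t0) ?_⟩
  rw [ContinuousMap.norm_le _ (norm_nonneg _)]
  exact fun s => ht0 (Set.mem_univ s)

theorem aux_bdd {𝕜 E : Type*} [RCLike 𝕜] [NormedAddCommGroup E] [NormedSpace 𝕜 E]
    (T : E →L[𝕜] E) : ∀ r ∈ (fun lam => ‖lam‖) '' numericalRange 𝕜 T, r ≤ ‖T‖ := by
  rintro _ ⟨_, ⟨x, f, hx, hf, -, rfl⟩, rfl⟩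
  have h1 := f.le_opNorm (T x)
  have h2 := T.le_opNorm x
  rw [hf, one_mul] at h1
  rw [hx, mul_one] at h2
  exact h1.trans h2

theorem aux_lumer1 {𝕜 E : Type*} [RCLike 𝕜] [NormedAddCommGroup E] [NormedSpace 𝕜 E]
    (T : E →L[𝕜] E) (c : 𝕜) (x : E) :
    ‖x‖ * (1 - ‖c‖ * numericalRadius 𝕜 T) ≤ ‖x - c • T x‖ := by
  by_cases hx : x = 0
  · simp [hx]
  have hxn : (‖x‖ : 𝕜) ≠ 0 := by simpa using hx
  have hxp : 0 < ‖x‖ := norm_pos_iff.2 hx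
  obtain ⟨f, hf, hfx⟩ := exists_dual_vector 𝕜 x hxp.ne'
  have hmem : ‖f (T ((‖x‖ : 𝕜)⁻¹ • x))‖ ≤ numericalRadius 𝕜 T := by
    apply le_csSup ⟨‖T‖, aux_bdd T⟩
    refine ⟨_, ⟨(‖x‖ : 𝕜)⁻¹ • x, f, ?_, hf, ?_, rfl⟩, rfl⟩
    · simp [norm_smul, hxp.ne']
    · simp [hfx, hx]
  have h1 : ‖f (T x)‖ ≤ ‖x‖ * numericalRadius 𝕜 T := by
    rw [map_smul, map_smul, norm_smul, norm_inv, RCLike.norm_ofReal, abs_norm,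
      inv_mul_le_iff₀ hxp] at hmem
    exact hmem
  have h2 := f.le_opNorm (x - c • T x)
  rw [hf, one_mul, map_sub, map_smul, hfx, smul_eq_mul] at h2
  have h3 := norm_sub_norm_le (‖x‖ : 𝕜) (c * f (T x))
  rw [norm_mul, RCLike.norm_ofReal, abs_norm] at h3
  have h4 := mul_le_mul_of_nonneg_left h1 (norm_nonneg c)
  nlinarith

theorem aux_lumer2 {𝕜 E : Type*} [RCLike 𝕜] [NormedAddCommGroup E] [NormedSpace 𝕜 E]
    (T : E →L[𝕜] E) (c : 𝕜) (x : E) (hT : ‖T‖ = 1) :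
    ‖x + c • T x‖ * (1 - ‖c‖ * numericalRadius 𝕜 T) ≤ (1 + ‖c‖ ^ 2) * ‖x‖ := by
  refine (aux_lumer1 T c (x + c • T x)).trans ?_
  have e : x + c • T x - c • T (x + c • T x) = x - (c ^ 2) • T (T x) := by
    rw [map_add, map_smul, smul_add, smul_smul, pow_two]; abel
  rw [e]
  have h1 := T.le_opNorm x
  have h2 := T.le_opNorm (T x)
  rw [hT, one_mul] at h1 h2
  refine (norm_sub_le _ _).trans ?_
  rw [norm_smul, norm_pow]
  have := mul_le_mul_of_nonneg_left (h2.trans h1) (sq_nonneg ‖c‖)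
  linarith

theorem aux_approx {𝕜 K : Type*} [RCLike 𝕜] [TopologicalSpace K] [CompactSpace K] [T2Space K]
    [Nonempty K] [PerfectSpace K]
    {X : Submodule 𝕜 C(K, 𝕜)} (hrich : CRich 𝕜 X) (T : X →L[𝕜] X) (hT : ‖T‖ = 1)
    (α : ℝ) (hα : 0 < α) (ε : ℝ) (hε : 0 < ε) :
    ∃ (z : X) (c : 𝕜), ‖c‖ = α ∧ ‖z‖ ≤ 1 + ε ∧ 1 - ε + α * (1 - 2 * ε) ≤ ‖z + c • T z‖ := by
  obtain ⟨x, hx, hTx⟩ := T.exists_lt_apply_of_lt_opNorm (r := 1 - ε) (by linarith)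
  obtain ⟨t0, ht0⟩ := aux_attain (T x : C(K, 𝕜))
  rw [← Submodule.coe_norm] at ht0
  obtain ⟨g, t, hy, -, hb⟩ := aux_key hrich 0 x (T x) hx.le t0 ε hε
  set a := (x : C(K, 𝕜)) t0 with ha
  have ha1 : ‖a‖ ≤ 1 := (ContinuousMap.norm_coe_le_norm (x : C(K, 𝕜)) t0).trans hx.le
  obtain ⟨b, hb1, hab⟩ := aux_unimodular a
  have hTt : 1 - 2 * ε ≤ ‖(T x : C(K, 𝕜)) t‖ := by
    have := norm_sub_norm_le ((T x : C(K, 𝕜)) t0) ((T x : C(K, 𝕜)) t)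
    rw [norm_sub_rev] at this
    linarith
  have hsplit : (T x : C(K, 𝕜)) t
      = (((1 + ‖a‖) / 2 : ℝ) : 𝕜) * (T (x + (b - a) • g) : C(K, 𝕜)) t
        + (((1 - ‖a‖) / 2 : ℝ) : 𝕜) * (T (x + (-b - a) • g) : C(K, 𝕜)) t := by
    simp only [map_add, map_smul, Submodule.coe_add, Submodule.coe_smul,
      ContinuousMap.add_apply, ContinuousMap.smul_apply, smul_eq_mul]
    push_cast
    linear_combination ((T g : X) : C(K, 𝕜)) t * hab
  have hex : ∃ d : 𝕜, ‖d‖ = 1 ∧ 1 - 2 * ε ≤ ‖(T (x + (d - a) • g) : C(K, 𝕜)) t‖ := by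
    by_contra hcon
    push Not at hcon
    have h1 := hcon b hb1
    have h2 := hcon (-b) (by simpa using hb1)
    have h3 := norm_add_le
      ((((1 + ‖a‖) / 2 : ℝ) : 𝕜) * (T (x + (b - a) • g) : C(K, 𝕜)) t)
      ((((1 - ‖a‖) / 2 : ℝ) : 𝕜) * (T (x + (-b - a) • g) : C(K, 𝕜)) t)
    rw [← hsplit, norm_mul, norm_mul, RCLike.norm_ofReal, RCLike.norm_ofReal,
      abs_of_nonneg (by positivity), abs_of_nonneg (by linarith)] at h3
    have h4 := mul_lt_mul_of_pos_left h1 (show 0 < (1 + ‖a‖) / 2 by positivity)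
    have h5 := mul_le_mul_of_nonneg_left h2.le (show 0 ≤ (1 - ‖a‖) / 2 by linarith)
    linarith
  obtain ⟨d, hd1, hd⟩ := hex
  obtain ⟨hz, hzt⟩ := hb d hd1
  set z := x + (d - a) • g with hzdef
  obtain ⟨u, hu1, hu⟩ := aux_unimodular ((T z : C(K, 𝕜)) t)
  set w := (T z : C(K, 𝕜)) t with hw
  have hu0 : u ≠ 0 := by
    intro h0; simp [h0] at hu1
  refine ⟨z, (α : 𝕜) * (d * u⁻¹), ?_, hz, ?_⟩
  · simp [hd1, hu1, abs_of_pos hα]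
  · have h1 := ContinuousMap.norm_coe_le_norm
      ((z + ((α : 𝕜) * (d * u⁻¹)) • T z : X) : C(K, 𝕜)) t
    rw [← Submodule.coe_norm] at h1
    refine le_trans ?_ h1
    have e : ((z + ((α : 𝕜) * (d * u⁻¹)) • T z : X) : C(K, 𝕜)) t
        = d * ((1 + α * ‖w‖ : ℝ) : 𝕜) - (d - (z : C(K, 𝕜)) t) := by
      have : ((z + ((α : 𝕜) * (d * u⁻¹)) • T z : X) : C(K, 𝕜)) t
        = (z : C(K, 𝕜)) t + ((α : 𝕜) * (d * u⁻¹)) * w := by simp [hw]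
      rw [this]
      have h3 : u⁻¹ * w = (‖w‖ : 𝕜) := by
        nth_rewrite 1 [hu]
        field_simp
      push_cast
      linear_combination ((α : 𝕜) * d) * h3
    rw [e]
    have h2 := norm_sub_norm_le (d * ((1 + α * ‖w‖ : ℝ) : 𝕜)) (d - (z : C(K, 𝕜)) t)
    rw [norm_mul, hd1, one_mul, RCLike.norm_ofReal, abs_of_nonneg (by positivity),
      norm_sub_rev d] at h2
    have := mul_le_mul_of_nonneg_left hd hα.le
    linarith

theorem aux_radius {𝕜 K : Type*} [RCLike 𝕜] [TopologicalSpace K] [CompactSpace K] [T2Space K]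
    [Nonempty K] [PerfectSpace K]
    {X : Submodule 𝕜 C(K, 𝕜)} (hrich : CRich 𝕜 X) (T : X →L[𝕜] X) (hT : ‖T‖ = 1) :
    1 ≤ numericalRadius 𝕜 T := by
  by_contra hlt
  push Not at hlt
  have hv0 : 0 ≤ numericalRadius 𝕜 T := by
    apply Real.sSup_nonneg
    rintro _ ⟨_, _, rfl⟩
    exact norm_nonneg _
  have hα : 0 < (1 - numericalRadius 𝕜 T) / 4 := by linarith
  have hve : numericalRadius 𝕜 T = 1 - 4 * ((1 - numericalRadius 𝕜 T) / 4) := by ring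
  set α := (1 - numericalRadius 𝕜 T) / 4 with hαe
  have hα4 : α ≤ 1 / 4 := by linarith
  have hε : 0 < α ^ 2 / 5 := by positivity
  obtain ⟨z, c, hc, hz, hzc⟩ := aux_approx hrich T hT α hα (α ^ 2 / 5) hε
  have h1 := aux_lumer2 T c z hT
  rw [hc] at h1
  have hp : 0 ≤ 1 - α * numericalRadius 𝕜 T := by nlinarith
  have h2 := mul_le_mul_of_nonneg_right hzc hp
  have h3 := mul_le_mul_of_nonneg_left hz (show 0 ≤ 1 + α ^ 2 by positivity)
  have h4 := h2.trans (h1.trans h3)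
  rw [hve] at h4
  set ε := α ^ 2 / 5 with hεe
  have hεα : α ^ 2 = 5 * ε := by rw [hεe]; ring
  have k1 : (ε + 2 * α * ε) * (1 - α * (1 - 4 * α)) ≤ (ε + 2 * α * ε) * 1 := by
    apply mul_le_mul_of_nonneg_left _ (by positivity)
    nlinarith
  have k2 : 2 * α * ε ≤ ε := by nlinarith
  have k3 : α ^ 2 * ε ≤ ε := by nlinarith
  have k4 : (1 + α) * (1 - α * (1 - 4 * α)) - (1 + α ^ 2) = 2 * α ^ 2 + 4 * α ^ 3 := by ring
  have k5 : 0 < α ^ 3 := by positivity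
  linarith

set_option maxHeartbeats 2000000 in
/-- If `K` is a perfect compact Hausdorff space and `X` is a C-rich closed subspace of
`C(K, 𝕜)`, then `n(X) = 1` and `X` has the Daugavet property. -/
theorem numericalIndex_eq_one_and_daugavet_of_cRich
    {𝕜 K : Type*} [RCLike 𝕜] [TopologicalSpace K] [CompactSpace K] [T2Space K] [Nonempty K]
    [PerfectSpace K] (X : Submodule 𝕜 C(K, 𝕜)) (hX : IsClosed (X : Set C(K, 𝕜)))
    (hrich : CRich 𝕜 X) :
    numericalIndex 𝕜 X = 1 ∧
      ∀ T : X →L[𝕜] X, (∃ (g : X →L[𝕜] 𝕜) (y : X), T = g.smulRight y) →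
        ‖(1 : X →L[𝕜] X) + T‖ = 1 + ‖T‖ := by
  constructor
  · have hne : ∃ x : X, x ≠ 0 := by
      obtain ⟨h, g, -, ⟨t, -, ht⟩, -, hg⟩ := aux_rich hrich Set.univ isOpen_univ
        Set.univ_nonempty (1 / 2) (by norm_num)
      refine ⟨g, fun h0 => ?_⟩
      have := hg t
      rw [h0, ht] at this
      norm_num at this
    obtain ⟨x0, hx0⟩ := hne
    have : Nontrivial X := ⟨x0, 0, hx0⟩
    have hid : ‖(1 : X →L[𝕜] X)‖ = 1 := norm_one
    have hmem : numericalRadius 𝕜 (1 : X →L[𝕜] X) ∈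
        numericalRadius 𝕜 '' {T : X →L[𝕜] X | ‖T‖ = 1} := ⟨1, hid, rfl⟩
    have hlow : ∀ r ∈ numericalRadius 𝕜 '' {T : X →L[𝕜] X | ‖T‖ = 1}, 1 ≤ r := by
      rintro _ ⟨T, hT, rfl⟩
      exact aux_radius hrich T hT
    apply le_antisymm
    · refine (csInf_le ⟨1, hlow⟩ hmem).trans ?_
      refine Real.sSup_le (fun r hr => ?_) zero_le_one
      exact (aux_bdd _ r hr).trans hid.le
    · exact le_csInf ⟨_, hmem⟩ hlow
  · rintro T ⟨φ, y, rfl⟩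
    apply le_antisymm
    · have h1 := norm_add_le (1 : X →L[𝕜] X) (φ.smulRight y)
      have h2 : ‖(1 : X →L[𝕜] X)‖ ≤ 1 := ContinuousLinearMap.norm_id_le
      exact h1.trans (by linarith)
    rw [ContinuousLinearMap.norm_smulRight_apply]
    set S : X →L[𝕜] X := 1 + φ.smulRight y with hS
    apply le_of_forall_pos_le_add
    intro δ hδ
    have hC : 0 < ‖S‖ + 1 + 3 * ‖y‖ + ‖φ‖ := by positivity
    have hε : 0 < δ / (‖S‖ + 1 + 3 * ‖y‖ + ‖φ‖) := by positivity
    have hεC : δ / (‖S‖ + 1 + 3 * ‖y‖ + ‖φ‖) * (‖S‖ + 1 + 3 * ‖y‖ + ‖φ‖) = δ := by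
      field_simp
    set ε := δ / (‖S‖ + 1 + 3 * ‖y‖ + ‖φ‖) with hεdef
    obtain ⟨x', hx', hφx'⟩ := φ.exists_lt_apply_of_lt_opNorm (r := ‖φ‖ - ε) (by linarith)
    obtain ⟨u, hu1, hu⟩ := aux_unimodular (φ x')
    have hu0 : u ≠ 0 := by
      intro h0; simp [h0] at hu1
    have hφu : φ (u⁻¹ • x') = (‖φ x'‖ : 𝕜) := by
      rw [map_smul, smul_eq_mul]
      nth_rewrite 1 [hu]
      field_simp
    have hxn : ‖u⁻¹ • x'‖ ≤ 1 := by
      rw [norm_smul, norm_inv, hu1]; simpa using hx'.le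
    set x := u⁻¹ • x' with hxdef
    set r := ‖φ x'‖ with hr
    have hr0 : 0 ≤ r := norm_nonneg _
    have hrφ : r ≤ ‖φ‖ := by
      have := φ.le_opNorm x'
      nlinarith [norm_nonneg φ]
    obtain ⟨t0, ht0⟩ := aux_attain (y : C(K, 𝕜))
    obtain ⟨b, hb1, hb⟩ := aux_unimodular ((y : C(K, 𝕜)) t0)
    rw [ht0, ← Submodule.coe_norm] at hb
    obtain ⟨g, t, hyt, hφg, hkey⟩ := aux_key hrich φ x y hxn t0 ε hε
    obtain ⟨hz, hzt⟩ := hkey b hb1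
    have hba : ‖b - (x : C(K, 𝕜)) t0‖ ≤ 2 := by
      have := (ContinuousMap.norm_coe_le_norm (x : C(K, 𝕜)) t0).trans hxn
      exact (norm_sub_le _ _).trans (by linarith)
    have hφz : ‖φ (x + (b - (x : C(K, 𝕜)) t0) • g) - (r : 𝕜)‖ ≤ 2 * ε := by
      rw [map_add, hφu, map_smul, add_sub_cancel_left, norm_smul]
      exact mul_le_mul hba hφg (norm_nonneg _) (by norm_num)
    set z := x + (b - (x : C(K, 𝕜)) t0) • g with hzdef
    have h1 := S.le_opNorm z
    have h2 := ContinuousMap.norm_coe_le_norm ((S z : X) : C(K, 𝕜)) t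
    rw [← Submodule.coe_norm] at h2
    have hv : ((S z : X) : C(K, 𝕜)) t = (z : C(K, 𝕜)) t + φ z * (y : C(K, 𝕜)) t := by
      simp [hS]
    have e : ((S z : X) : C(K, 𝕜)) t = b * ((1 + r * ‖y‖ : ℝ) : 𝕜)
        + (((z : C(K, 𝕜)) t - b) + (φ z - (r : 𝕜)) * (y : C(K, 𝕜)) t
          + (r : 𝕜) * ((y : C(K, 𝕜)) t - (y : C(K, 𝕜)) t0)) := by
      rw [hv, hb]; push_cast; ring
    have h3 : ‖((z : C(K, 𝕜)) t - b) + (φ z - (r : 𝕜)) * (y : C(K, 𝕜)) t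
          + (r : 𝕜) * ((y : C(K, 𝕜)) t - (y : C(K, 𝕜)) t0)‖ ≤ ε + 2 * ε * ‖y‖ + ‖φ‖ * ε := by
      refine norm_add₃_le.trans ?_
      rw [norm_mul, norm_mul, RCLike.norm_ofReal, abs_of_nonneg hr0]
      have hyn : ‖(y : C(K, 𝕜)) t‖ ≤ ‖y‖ := ContinuousMap.norm_coe_le_norm (y : C(K, 𝕜)) t
      have k1 : ‖φ z - (r : 𝕜)‖ * ‖(y : C(K, 𝕜)) t‖ ≤ 2 * ε * ‖y‖ :=
        mul_le_mul hφz hyn (norm_nonneg _) (by positivity)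
      have k2 : r * ‖(y : C(K, 𝕜)) t - (y : C(K, 𝕜)) t0‖ ≤ ‖φ‖ * ε :=
        mul_le_mul hrφ hyt (norm_nonneg _) φ.opNorm_nonneg
      linarith
    have h4 : 1 + r * ‖y‖ - (ε + 2 * ε * ‖y‖ + ‖φ‖ * ε) ≤ ‖((S z : X) : C(K, 𝕜)) t‖ := by
      have h5 : ‖b * ((1 + r * ‖y‖ : ℝ) : 𝕜)‖ = 1 + r * ‖y‖ := by
        rw [norm_mul, hb1, one_mul, RCLike.norm_ofReal, abs_of_nonneg (by positivity)]
      rw [e]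
      have := norm_sub_le_norm_add (b * ((1 + r * ‖y‖ : ℝ) : 𝕜))
        (((z : C(K, 𝕜)) t - b) + (φ z - (r : 𝕜)) * (y : C(K, 𝕜)) t
          + (r : 𝕜) * ((y : C(K, 𝕜)) t - (y : C(K, 𝕜)) t0))
      linarith
    have h6 : ‖S‖ * ‖z‖ ≤ ‖S‖ * (1 + ε) := mul_le_mul_of_nonneg_left hz S.opNorm_nonneg
    have h7 : (‖φ‖ - ε) * ‖y‖ ≤ r * ‖y‖ := mul_le_mul_of_nonneg_right hφx'.le (norm_nonneg _)
    linarith
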